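/- arXiv:1712.03898 — 2 statements merged into one kernel-verified Lean document; each statement's English description precedes it below -/
import Mathlib

section
/- For integers m ≥ 0 and v, v̄ ≥ 0 with v + v̄ ≤ m, the Hadamard product of binary Reed–Muller codes satisfies R(v,m) ∘ R(v̄,m) = R(v+v̄, m), as subspaces of the space of functions GF(2)^m → GF(2). -/
open scoped Classical

/-- The linear map sending a polynomial in `m` variables over `GF(2)` to its evaluation
function `GF(2)^m → GF(2)`. -/
noncomputable def evalLM (m : ℕ) :
    MvPolynomial (Fin m) (ZMod 2) →ₗ[ZMod 2] ((Fin m → ZMod 2) → ZMod 2) where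
  toFun f := fun μ => MvPolynomial.eval μ f
  map_add' f g := by funext μ; simp
  map_smul' c f := by funext μ; simp [MvPolynomial.smul_eval]

/-- The `w`-th order binary Reed–Muller code `R(w,m)`: the space of evaluation maps of
`m`-variable polynomials over `GF(2)` of total degree at most `w`. -/
noncomputable def RM (w m : ℕ) : Submodule (ZMod 2) ((Fin m → ZMod 2) → ZMod 2) :=
  (MvPolynomial.restrictTotalDegree (Fin m) (ZMod 2) w).map (evalLM m)

/-- The Hadamard product of two subspaces of the function space `(GF(2)^m → GF(2))`: the span
of all pointwise products. -/
def hadamardCode {X F : Type*} [Fintype X] [Field F]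
    (C D : Submodule F (X → F)) : Submodule F (X → F) :=
  Submodule.span F {z | ∃ x ∈ C, ∃ y ∈ D, z = fun j => x j * y j}

/-- An exponent vector of degree at most `a + b` splits into exponent vectors of degrees at most
`a` and `b`. -/
theorem Finsupp.exists_add_eq_of_degree_le_add {σ : Type*} {a b : ℕ} {s : σ →₀ ℕ}
    (hs : s.degree ≤ a + b) :
    ∃ t u : σ →₀ ℕ, t + u = s ∧ t.degree ≤ a ∧ u.degree ≤ b := by
  obtain ⟨t, hts, ht⟩ := s.exists_le_degree_eq (min a s.degree) (min_le_right _ _)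
  obtain ⟨u, rfl⟩ := exists_add_of_le hts
  rw [map_add] at hs ht
  exact ⟨t, u, rfl, by omega, by omega⟩

theorem evalLM_mul (m : ℕ) (f g : MvPolynomial (Fin m) (ZMod 2)) :
    evalLM m (f * g) = evalLM m f * evalLM m g := by
  funext μ
  simp [evalLM]

theorem evalLM_mem_RM {m w : ℕ} {f : MvPolynomial (Fin m) (ZMod 2)} (hf : f.totalDegree ≤ w) :
    evalLM m f ∈ RM w m :=
  Submodule.mem_map_of_mem ((MvPolynomial.mem_restrictTotalDegree _ _ _).mpr hf)

/-- For `v + v̄ ≤ m`, the Hadamard product of binary Reed–Muller codes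
satisfies `R(v,m) ∘ R(v̄,m) = R(v+v̄,m)`. -/
theorem reed_muller_hadamard (m v vbar : ℕ) (h : v + vbar ≤ m) :
    hadamardCode (RM v m) (RM vbar m) = RM (v + vbar) m := by
  apply le_antisymm
  · refine Submodule.span_le.mpr ?_
    rintro _ ⟨_, ⟨f, hf, rfl⟩, _, ⟨g, hg, rfl⟩, rfl⟩
    have hf' := (MvPolynomial.mem_restrictTotalDegree _ _ _).mp hf
    have hg' := (MvPolynomial.mem_restrictTotalDegree _ _ _).mp hg
    change evalLM m f * evalLM m g ∈ RM (v + vbar) m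
    rw [← evalLM_mul]
    exact evalLM_mem_RM ((MvPolynomial.totalDegree_mul f g).trans (add_le_add hf' hg'))
  · rintro _ ⟨f, hf, rfl⟩
    have hf' := (MvPolynomial.mem_restrictTotalDegree _ _ _).mp hf
    rw [f.as_sum, map_sum]
    refine Submodule.sum_mem _ fun s hs => ?_
    obtain ⟨t, u, rfl, ht, hu⟩ := Finsupp.exists_add_eq_of_degree_le_add
      ((MvPolynomial.le_totalDegree hs).trans hf')
    rw [← mul_one (f.coeff (t + u)), ← MvPolynomial.monomial_mul, evalLM_mul]
    exact Submodule.subset_span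
      ⟨_, evalLM_mem_RM ((MvPolynomial.totalDegree_monomial_le t _).trans ht),
        _, evalLM_mem_RM ((MvPolynomial.totalDegree_monomial_le u _).trans hu), rfl⟩
end

section
/- For integers m ≥ 0 and v, v̄ ≥ 0 with v+v̄ ≤ m, set n = 2^m, k = Σ_{i=0}^v binom(m,i), k̃ = Σ_{i=0}^{v+v̄} binom(m,i), C = R(v,m), C̄ = R(v̄,m), and C̃ = C ∘ C̄ (which equals R(v+v̄,m) and has dimension k̃). Then there exist k information sets of C̃ and n−k̃ information sets of C such that every point of GF(2)^m belongs to exactly k sets of the combined collection (counted with multiplicity); i.e., a PIR maximum rate matrix Λ̃_{k,k+n−k̃} exists for (C,C̄). -/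
open scoped Classical

/-- `I` is an information set of the linear code `C ⊆ F^X`: it has size `dim C` and the
restriction map `C → F^I`, `c ↦ c|_I`, is injective. -/
def IsInformationSet {X F : Type*} [Fintype X] [Field F]
    (C : Submodule F (X → F)) (I : Finset X) : Prop :=
  I.card = Module.finrank F C ∧
    ∀ x y : C, (∀ i ∈ I, (x : X → F) i = (y : X → F) i) → x = y

/-- The function `x ↦ ∏ i ∈ S, (x i + a i)`. -/
noncomputable def shiftedMonomial {m : ℕ} (a : Fin m → ZMod 2) (S : Finset (Fin m)) :
    (Fin m → ZMod 2) → ZMod 2 :=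
  fun x => ∏ i ∈ S, (x i + a i)

theorem shiftedMonomial_mem_RM {m w : ℕ} (a : Fin m → ZMod 2) {S : Finset (Fin m)}
    (hS : S.card ≤ w) : shiftedMonomial a S ∈ RM w m := by
  refine ⟨∏ i ∈ S, (MvPolynomial.X i + MvPolynomial.C (a i)), ?_, ?_⟩
  · rw [SetLike.mem_coe, MvPolynomial.mem_restrictTotalDegree]
    refine (MvPolynomial.totalDegree_finsetProd _ _).trans ?_
    refine (Finset.sum_le_card_nsmul S _ 1 fun i _ => ?_).trans (by simpa using hS)
    refine (MvPolynomial.totalDegree_add _ _).trans ?_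
    simp
  · funext x
    simp [evalLM, shiftedMonomial, map_prod]

theorem RM_eq_span (w m : ℕ) :
    RM w m = Submodule.span (ZMod 2)
      (Set.range fun S : {S : Finset (Fin m) // S.card ≤ w} => shiftedMonomial 0 S.1) := by
  apply le_antisymm
  · rintro _ ⟨f, hf, rfl⟩
    rw [SetLike.mem_coe, MvPolynomial.mem_restrictTotalDegree] at hf
    rw [f.as_sum, map_sum]
    refine Submodule.sum_mem _ fun d hd => ?_
    have hcard : d.support.card ≤ w := by
      refine le_trans ?_ ((MvPolynomial.le_totalDegree hd).trans hf)
      rw [Finset.card_eq_sum_ones]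
      exact Finset.sum_le_sum fun i hi => Nat.one_le_iff_ne_zero.2 (Finsupp.mem_support_iff.1 hi)
    have heq : evalLM m (MvPolynomial.monomial d (f.coeff d)) =
        f.coeff d • shiftedMonomial 0 d.support := by
      funext x
      simp only [evalLM, LinearMap.coe_mk, AddHom.coe_mk, MvPolynomial.eval_monomial,
        Pi.smul_apply, smul_eq_mul, shiftedMonomial, Finsupp.prod, Pi.zero_apply, add_zero]
      congr 1
      refine Finset.prod_congr rfl fun i hi => ?_
      have idem : IsIdempotentElem (x i) := by
        generalize x i = y
        revert y
        unfold IsIdempotentElem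
        decide
      exact idem.pow_eq (Finsupp.mem_support_iff.1 hi)
    rw [heq]
    exact Submodule.smul_mem _ _ (Submodule.subset_span ⟨⟨_, hcard⟩, rfl⟩)
  · rw [Submodule.span_le]
    rintro _ ⟨S, rfl⟩
    exact shiftedMonomial_mem_RM 0 S.2

theorem hadamardCode_RM (v vbar m : ℕ) :
    hadamardCode (RM v m) (RM vbar m) = RM (v + vbar) m := by
  apply le_antisymm
  · rw [hadamardCode, Submodule.span_le]
    rintro _ ⟨_, ⟨f, hf, rfl⟩, _, ⟨g, hg, rfl⟩, rfl⟩
    rw [SetLike.mem_coe, MvPolynomial.mem_restrictTotalDegree] at hf hg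
    refine ⟨f * g, ?_, by funext x; simp [evalLM]⟩
    rw [SetLike.mem_coe, MvPolynomial.mem_restrictTotalDegree]
    exact (MvPolynomial.totalDegree_mul f g).trans (add_le_add hf hg)
  · rw [RM_eq_span (v + vbar), Submodule.span_le]
    rintro _ ⟨⟨S, hS⟩, rfl⟩
    obtain ⟨T, hTS, hT⟩ := Finset.exists_subset_card_eq (min_le_left S.card v)
    refine Submodule.subset_span ⟨shiftedMonomial 0 T, shiftedMonomial_mem_RM 0 (by omega),
      shiftedMonomial 0 (S \ T), shiftedMonomial_mem_RM 0 ?_, ?_⟩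
    · rw [Finset.card_sdiff_of_subset hTS]
      omega
    · funext x
      simp only [shiftedMonomial]
      rw [mul_comm, Finset.prod_sdiff hTS]

/-- Binary vectors correspond to their supports. -/
noncomputable def supportEquiv (m : ℕ) : (Fin m → ZMod 2) ≃ Finset (Fin m) where
  toFun x := Finset.univ.filter fun i => x i ≠ 0
  invFun S := fun i => if i ∈ S then 1 else 0
  left_inv x := by
    funext i
    have key : ∀ y : ZMod 2, (if y ≠ 0 then (1 : ZMod 2) else 0) = y := by decide
    simpa using key (x i)
  right_inv S := by ext i; simp

/-- The Hamming ball of radius `w` around `a`. -/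
noncomputable def hammingBall {m : ℕ} (a : Fin m → ZMod 2) (w : ℕ) : Finset (Fin m → ZMod 2) :=
  Finset.univ.filter fun x => (supportEquiv m (x + a)).card ≤ w

theorem binaryVector_add_self {m : ℕ} (x : Fin m → ZMod 2) : x + x = 0 :=
  funext fun i => CharTwo.add_self_eq_zero (x i)

/-- The vectors in a Hamming ball correspond to the sets of cardinality at most its radius. -/
noncomputable def hammingBallEquiv {m : ℕ} (a : Fin m → ZMod 2) (w : ℕ) :
    hammingBall a w ≃ {S : Finset (Fin m) // S.card ≤ w} :=
  ((Equiv.addRight a).trans (supportEquiv m)).subtypeEquiv fun x => by simp [hammingBall]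

theorem card_finset_card_le (m w : ℕ) :
    Fintype.card {S : Finset (Fin m) // S.card ≤ w} =
      ∑ i ∈ Finset.range (w + 1), m.choose i := by
  rw [Fintype.card_subtype, Finset.card_eq_sum_card_fiberwise (f := Finset.card)
    (t := Finset.range (w + 1)) (by intro S hS; simpa [Nat.lt_succ_iff] using hS)]
  refine Finset.sum_congr rfl fun i hi => ?_
  have : (Finset.univ.filter fun S : Finset (Fin m) => S.card ≤ w).filter (fun S => S.card = i) =
      Finset.powersetCard i Finset.univ := by
    ext S
    simp only [Finset.mem_filter, Finset.mem_univ, true_and, Finset.mem_powersetCard,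
      Finset.subset_univ]
    have := Finset.mem_range.1 hi
    omega
  rw [this, Finset.card_powersetCard, Finset.card_univ, Fintype.card_fin]

theorem linearIndependent_shiftedMonomial_restrict {m : ℕ} (a : Fin m → ZMod 2) (w : ℕ) :
    LinearIndependent (ZMod 2) fun S : {S : Finset (Fin m) // S.card ≤ w} =>
      LinearMap.funLeft (ZMod 2) (ZMod 2) (Subtype.val : hammingBall a w → _)
        (shiftedMonomial a S.1) := by
  rw [Fintype.linearIndependent_iff]
  intro c hc
  have hval : ∀ T : {S : Finset (Fin m) // S.card ≤ w},
      ∑ S : {S : Finset (Fin m) // S.card ≤ w}, (if S.1 ⊆ T.1 then c S else 0) = 0 := by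
    intro T
    have h0 := congrFun hc ((hammingBallEquiv a w).symm T)
    simp only [Finset.sum_apply, Pi.smul_apply, smul_eq_mul, Pi.zero_apply] at h0
    refine Eq.trans (Finset.sum_congr rfl fun S _ => ?_) h0
    have hpt : ∀ i, ((hammingBallEquiv a w).symm T).1 i + a i = if i ∈ T.1 then 1 else 0 := by
      intro i
      change (((supportEquiv m).symm T.1 + -a) i + a i : ZMod 2) = _
      simp [supportEquiv, add_assoc, CharTwo.add_self_eq_zero]
    simp only [LinearMap.funLeft_apply, shiftedMonomial, hpt]
    rw [Finset.prod_ite_zero]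
    rw [Finset.prod_const_one, mul_ite, mul_one, mul_zero]
    rfl
  have main : ∀ n, ∀ T : {S : Finset (Fin m) // S.card ≤ w}, T.1.card = n → c T = 0 := by
    intro n
    induction n using Nat.strong_induction_on with
    | _ n ih =>
      intro T hT
      rw [← hval T, Finset.sum_eq_single T]
      · simp
      · intro S _ hST
        split_ifs with hsub
        · exact ih _ (hT ▸ Finset.card_lt_card
            (hsub.ssubset_of_ne fun h => hST (Subtype.ext h))) S rfl
        · rfl
      · simp
  exact fun T => main _ T rfl

theorem isInformationSet_hammingBall {m : ℕ} (a : Fin m → ZMod 2) (w : ℕ) :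
    IsInformationSet (RM w m) (hammingBall a w) := by
  set r := (LinearMap.funLeft (ZMod 2) (ZMod 2) (Subtype.val : hammingBall a w → _)).domRestrict
    (RM w m) with hr
  have hball : (hammingBall a w).card = Fintype.card {S : Finset (Fin m) // S.card ≤ w} := by
    rw [← Fintype.card_coe]
    exact Fintype.card_congr (hammingBallEquiv a w)
  have hle : Module.finrank (ZMod 2) (RM w m) ≤
      Fintype.card {S : Finset (Fin m) // S.card ≤ w} := by
    rw [RM_eq_span]
    exact finrank_range_le_card _
  have hge : Fintype.card {S : Finset (Fin m) // S.card ≤ w} ≤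
      Module.finrank (ZMod 2) (LinearMap.range r) := by
    rw [← finrank_span_eq_card (linearIndependent_shiftedMonomial_restrict a w)]
    refine Submodule.finrank_mono (Submodule.span_le.2 ?_)
    rintro _ ⟨S, rfl⟩
    exact ⟨⟨_, shiftedMonomial_mem_RM a S.2⟩, rfl⟩
  have hrank := r.finrank_range_add_finrank_ker
  refine ⟨by omega, fun x y hxy => ?_⟩
  have hker : LinearMap.ker r = ⊥ := Submodule.finrank_eq_zero.1 (by omega)
  exact LinearMap.ker_eq_bot.1 hker (funext fun i => hxy i.1 i.2)

theorem card_hammingBall {m : ℕ} (a : Fin m → ZMod 2) (w : ℕ) :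
    (hammingBall a w).card = ∑ i ∈ Finset.range (w + 1), m.choose i := by
  rw [← card_finset_card_le, ← Fintype.card_coe]
  exact Fintype.card_congr (hammingBallEquiv a w)

theorem card_filter_mem_hammingBall {m k w : ℕ} {s : Finset (Fin m → ZMod 2)}
    (e : Fin k ≃ s) (x : Fin m → ZMod 2) :
    (Finset.univ.filter fun i => x ∈ hammingBall (e i).1 w).card =
      (s.filter fun a => x ∈ hammingBall a w).card := by
  refine Finset.card_bij (fun i _ => (e i).1) ?_ ?_ ?_
  · intro i hi
    simpa using hi
  · intro i _ j _ hij
    exact e.injective (Subtype.ext hij)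
  · intro a ha
    rw [Finset.mem_filter] at ha
    exact ⟨e.symm ⟨a, ha.1⟩, by simpa using ha.2, by simp⟩

/-- For `v + v̄ ≤ m`, set `n = 2^m`, `k = Σ_{i=0}^{v} C(m,i)`,
`k̃ = Σ_{i=0}^{v+v̄} C(m,i)`, `C = R(v,m)`, `C̄ = R(v̄,m)`, `C̃ = C ∘ C̄`.  Then there exist `k`
information sets of `C̃` and `n−k̃` information sets of `C` such that every point of `GF(2)^m`
belongs to exactly `k` sets of the combined collection (with multiplicity): a PIR maximum rate
matrix `Λ̃_{k,k+n−k̃}` exists for `(C,C̄)`. -/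
theorem reed_muller_pir_max_rate_matrix (m v vbar : ℕ) (h : v + vbar ≤ m) :
    ∃ Itil : Fin (∑ i ∈ Finset.range (v + 1), m.choose i) → Finset (Fin m → ZMod 2),
    ∃ I : Fin (2 ^ m - ∑ i ∈ Finset.range (v + vbar + 1), m.choose i) →
        Finset (Fin m → ZMod 2),
      (∀ i, IsInformationSet (hadamardCode (RM v m) (RM vbar m)) (Itil i)) ∧
      (∀ t, IsInformationSet (RM v m) (I t)) ∧
      ∀ x : Fin m → ZMod 2,
        (Finset.univ.filter fun i => x ∈ Itil i).card +
          (Finset.univ.filter fun t => x ∈ I t).card =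
            ∑ i ∈ Finset.range (v + 1), m.choose i := by
  have hk : Fintype.card (hammingBall (0 : Fin m → ZMod 2) v) =
      ∑ i ∈ Finset.range (v + 1), m.choose i := by
    rw [Fintype.card_coe, card_hammingBall]
  have hn : Fintype.card ((hammingBall (0 : Fin m → ZMod 2) (v + vbar))ᶜ : Finset _) =
      2 ^ m - ∑ i ∈ Finset.range (v + vbar + 1), m.choose i := by
    rw [Fintype.card_coe, Finset.card_compl, card_hammingBall]
    simp
  let e := (Fintype.equivFinOfCardEq hk).symm
  let e' := (Fintype.equivFinOfCardEq hn).symm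
  refine ⟨fun i => hammingBall (e i).1 (v + vbar), fun t => hammingBall (e' t).1 v,
    fun i => ?_, fun t => isInformationSet_hammingBall _ _, fun x => ?_⟩
  · rw [hadamardCode_RM]
    exact isInformationSet_hammingBall _ _
  · rw [card_filter_mem_hammingBall, card_filter_mem_hammingBall,
      ← card_hammingBall (0 : Fin m → ZMod 2) v,
      ← Finset.card_filter_add_card_filter_not (s := hammingBall (0 : Fin m → ZMod 2) v)
        (fun a => x ∈ hammingBall a (v + vbar))]
    congr 1
    refine Finset.card_nbij' (x + ·) (x + ·) ?_ ?_ ?_ ?_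
    · intro b hb
      simp_all [hammingBall, ← add_assoc, binaryVector_add_self]
    · intro b hb
      simp_all [hammingBall, ← add_assoc, binaryVector_add_self]
    · intro b _
      simp [← add_assoc, binaryVector_add_self]
    · intro b _
      simp [← add_assoc, binaryVector_add_self]
end
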